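/- arXiv:1507.00852 — 3 statements merged into one kernel-verified Lean document; each statement's English description precedes it below -/
import Mathlib

section
/- Let H and G be real Hilbert spaces, let V : H → H and W : G → G be bounded self-adjoint strongly positive linear operators, and let D : H → G be bounded linear. Suppose there exists κ ∈ [0, 1) such that ⟨W(D w), D w⟩ ≤ κ² ⟨V^{−1} w, w⟩ for every w ∈ H (equivalently, ‖W^{1/2} D V^{1/2}‖ ≤ κ < 1). Then the bounded linear operator M : H × G → H × G defined by M(w, v) = (V^{−1} w − D^* v, W^{−1} v − D w) is self-adjoint and strongly positive: there exists ρ > 0 such that ⟨M(w, v), (w, v)⟩ ≥ ρ(‖w‖² + ‖v‖²) for all (w, v) ∈ H × G. -/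
open RealInnerProductSpace

section StronglyPositive

variable {E : Type*} [NormedAddCommGroup E] [InnerProductSpace ℝ E] {U U' : E →L[ℝ] E}

/-- The inverse of a symmetric operator is symmetric. -/
theorem inner_inverse_left_eq_right (hU : ∀ x y : E, ⟪U x, y⟫ = ⟪x, U y⟫)
    (hinv : ∀ x : E, U (U' x) = x) (x y : E) : ⟪U' x, y⟫ = ⟪x, U' y⟫ := by
  simpa only [hinv] using (hU (U' x) (U' y)).symm

/-- The inverse of a bounded strongly positive operator is strongly positive. -/
theorem exists_pos_mul_norm_sq_le_inner_inverse
    (hU : ∃ ρ > (0 : ℝ), ∀ x : E, ρ * ‖x‖ ^ 2 ≤ ⟪U x, x⟫) (hinv : ∀ x : E, U (U' x) = x) :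
    ∃ σ > (0 : ℝ), ∀ x : E, σ * ‖x‖ ^ 2 ≤ ⟪U' x, x⟫ := by
  obtain ⟨ρ, hρ, h⟩ := hU
  refine ⟨ρ / (‖U‖ ^ 2 + 1), by positivity, fun x => ?_⟩
  have hx : ρ * ‖U' x‖ ^ 2 ≤ ⟪U' x, x⟫ := by
    simpa only [hinv, real_inner_comm] using h (U' x)
  have hn : ‖x‖ ≤ ‖U‖ * ‖U' x‖ := by
    simpa only [hinv] using U.le_opNorm (U' x)
  have hn2 : ‖x‖ ^ 2 ≤ (‖U‖ ^ 2 + 1) * ‖U' x‖ ^ 2 := by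
    have := pow_le_pow_left₀ (norm_nonneg x) hn 2
    nlinarith [sq_nonneg ‖U' x‖]
  calc ρ / (‖U‖ ^ 2 + 1) * ‖x‖ ^ 2
      ≤ ρ / (‖U‖ ^ 2 + 1) * ((‖U‖ ^ 2 + 1) * ‖U' x‖ ^ 2) := by gcongr
    _ = ρ * ‖U' x‖ ^ 2 := by field_simp
    _ ≤ ⟪U' x, x⟫ := hx

/-- Young's inequality for the form of a positive symmetric operator and that of its inverse. -/
theorem two_mul_inner_le_inner_add_inner_inverse (hsa : ∀ x y : E, ⟪U x, y⟫ = ⟪x, U y⟫)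
    (hpos : ∀ x : E, 0 ≤ ⟪U x, x⟫) (hinv : ∀ x : E, U (U' x) = x) (t : ℝ) (x y : E) :
    2 * t * ⟪x, y⟫ ≤ ⟪U x, x⟫ + t ^ 2 * ⟪U' y, y⟫ := by
  have h := hpos (x - t • U' y)
  have hxy : ⟪U x, U' y⟫ = ⟪x, y⟫ := by rw [hsa, hinv]
  simp only [map_sub, map_smul, hinv, inner_sub_left, inner_sub_right, real_inner_smul_left,
    real_inner_smul_right, hxy, real_inner_comm x y, real_inner_comm (U' y) y] at h
  linarith [real_inner_comm x y, real_inner_comm (U' y) y]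

end StronglyPositive

/-- if `V`, `W` are bounded self-adjoint strongly positive operators (with
inverses `V'`, `W'`) and `⟨W(Dw), Dw⟩ ≤ κ²⟨V' w, w⟩` for some `κ ∈ [0,1)`, then the
operator `M(w,v) = (V' w − D* v, W' v − D w)` on `H × G` is self-adjoint and strongly
positive for the product inner product `⟨(w,v),(w',v')⟩ = ⟨w,w'⟩ + ⟨v,v'⟩`. -/
theorem preconditioner_strongly_positive
    {H G : Type*} [NormedAddCommGroup H] [InnerProductSpace ℝ H] [CompleteSpace H]
    [NormedAddCommGroup G] [InnerProductSpace ℝ G] [CompleteSpace G]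
    (V V' : H →L[ℝ] H) (W W' : G →L[ℝ] G) (D : H →L[ℝ] G)
    (hV_sa : ∀ x y : H, ⟪V x, y⟫ = ⟪x, V y⟫)
    (hW_sa : ∀ x y : G, ⟪W x, y⟫ = ⟪x, W y⟫)
    (hV_pos : ∃ ρ > (0:ℝ), ∀ x : H, ρ * ‖x‖ ^ 2 ≤ ⟪V x, x⟫)
    (hW_pos : ∃ ρ > (0:ℝ), ∀ x : G, ρ * ‖x‖ ^ 2 ≤ ⟪W x, x⟫)
    (hV' : (∀ x : H, V (V' x) = x) ∧ (∀ x : H, V' (V x) = x))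
    (hW' : (∀ x : G, W (W' x) = x) ∧ (∀ x : G, W' (W x) = x))
    (κ : ℝ) (hκ0 : 0 ≤ κ) (hκ1 : κ < 1)
    (hbound : ∀ w : H, ⟪W (D w), D w⟫ ≤ κ ^ 2 * ⟪V' w, w⟫) :
    -- `M` is self-adjoint:
    (∀ (w w' : H) (v v' : G),
      ⟪V' w - (ContinuousLinearMap.adjoint D) v, w'⟫ + ⟪W' v - D w, v'⟫ =
      ⟪w, V' w' - (ContinuousLinearMap.adjoint D) v'⟫ + ⟪v, W' v' - D w'⟫) ∧
    -- `M` is strongly positive: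
    (∃ ρ > (0:ℝ), ∀ (w : H) (v : G),
      ρ * (‖w‖ ^ 2 + ‖v‖ ^ 2) ≤
        ⟪V' w - (ContinuousLinearMap.adjoint D) v, w⟫ + ⟪W' v - D w, v⟫) := by
  refine ⟨fun w w' v v' => ?_, ?_⟩
  · simp only [inner_sub_left, inner_sub_right, ContinuousLinearMap.adjoint_inner_left,
      ContinuousLinearMap.adjoint_inner_right, inner_inverse_left_eq_right hV_sa hV'.1 w w',
      inner_inverse_left_eq_right hW_sa hW'.1 v v']
    ring
  obtain ⟨σ, hσ, hσV⟩ := exists_pos_mul_norm_sq_le_inner_inverse hV_pos hV'.1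
  obtain ⟨τ, hτ, hτW⟩ := exists_pos_mul_norm_sq_le_inner_inverse hW_pos hW'.1
  have hW_nonneg (x : G) : 0 ≤ ⟪W x, x⟫ := by
    obtain ⟨ρ, hρ, h⟩ := hW_pos
    exact le_trans (by positivity) (h x)
  -- enlarge `κ` to a positive constant, so that one can divide by it
  obtain ⟨t, hκt, ht1⟩ := exists_between hκ1
  have ht0 : 0 < t := hκ0.trans_lt hκt
  refine ⟨(1 - t) * min σ τ, mul_pos (sub_pos.2 ht1) (lt_min hσ hτ), fun w v => ?_⟩
  have hVw : min σ τ * ‖w‖ ^ 2 ≤ ⟪V' w, w⟫ :=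
    le_trans (by gcongr; exact min_le_left _ _) (hσV w)
  have hWv : min σ τ * ‖v‖ ^ 2 ≤ ⟪W' v, v⟫ :=
    le_trans (by gcongr; exact min_le_right _ _) (hτW v)
  have hV_nonneg : 0 ≤ ⟪V' w, w⟫ := le_trans (by positivity) (hσV w)
  have hD : ⟪W (D w), D w⟫ ≤ t ^ 2 * ⟪V' w, w⟫ := (hbound w).trans (by gcongr)
  have hcross : 2 * ⟪D w, v⟫ ≤ t * (⟪V' w, w⟫ + ⟪W' v, v⟫) := by
    have := two_mul_inner_le_inner_add_inner_inverse hW_sa hW_nonneg hW'.1 t (D w) v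
    refine le_of_mul_le_mul_left ?_ ht0
    linarith
  have hlow := mul_le_mul_of_nonneg_left (add_le_add hVw hWv) (sub_pos.2 ht1).le
  rw [inner_sub_left, inner_sub_left, ContinuousLinearMap.adjoint_inner_left,
    real_inner_comm (D w) v]
  linarith
end

section
/- Let H and G be real Hilbert spaces, let V : H → H and W : G → G be bounded self-adjoint strongly positive linear operators, and let D : H → G be bounded linear. Suppose there exists κ ∈ [0, 1) such that ⟨V(D^* v), D^* v⟩ ≤ κ² ⟨W^{−1} v, v⟩ for every v ∈ G (equivalently, ‖W^{1/2} D V^{1/2}‖ ≤ κ < 1). Then the bounded linear operator W^{−1} − D V D^* : G → G is self-adjoint and strongly positive; in fact ⟨(W^{−1} − D V D^*) v, v⟩ ≥ (1 − κ²)⟨W^{−1} v, v⟩ ≥ ((1 − κ²)/‖W‖)‖v‖² for all v ∈ G. -/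
open RealInnerProductSpace

/-- A symmetric positive operator `T` satisfies `‖T x‖² ≤ ‖T‖ ⟪T x, x⟫`. -/
theorem norm_sq_apply_le_opNorm_mul_inner {E : Type*} [NormedAddCommGroup E]
    [InnerProductSpace ℝ E] (T : E →L[ℝ] E) (hsymm : ∀ x y : E, ⟪T x, y⟫ = ⟪x, T y⟫)
    (hpos : ∀ x : E, 0 ≤ ⟪T x, x⟫) (x : E) : ‖T x‖ ^ 2 ≤ ‖T‖ * ⟪T x, x⟫ := by
  have hquad := hpos (‖T‖ • x - T x)
  have hTT : ⟪T (T x), T x⟫ ≤ ‖T‖ * ‖T x‖ ^ 2 :=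
    calc ⟪T (T x), T x⟫ ≤ ‖T (T x)‖ * ‖T x‖ := real_inner_le_norm _ _
      _ ≤ (‖T‖ * ‖T x‖) * ‖T x‖ := by gcongr; exact T.le_opNorm _
      _ = ‖T‖ * ‖T x‖ ^ 2 := by ring
  simp only [map_sub, map_smul, inner_sub_left, inner_sub_right, real_inner_smul_left,
    real_inner_smul_right, hsymm (T x) x, real_inner_self_eq_norm_sq] at hquad
  rcases (norm_nonneg T).eq_or_lt with h0 | h0
  · simp [norm_eq_zero.mp h0.symm]
  · exact le_of_mul_le_mul_left (by nlinarith) h0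

/-- with `V`, `W` bounded self-adjoint strongly positive (with inverses
`V'`, `W'`) and `⟨V(D* v), D* v⟩ ≤ κ²⟨W' v, v⟩` for some `κ ∈ [0,1)`, the operator
`W' − D V D*` is self-adjoint and strongly positive, with
`⟨(W' − D V D*) v, v⟩ ≥ (1 − κ²)⟨W' v, v⟩ ≥ ((1 − κ²)/‖W‖)‖v‖²`. -/
theorem dual_preconditioner_strongly_positive
    {H G : Type*} [NormedAddCommGroup H] [InnerProductSpace ℝ H] [CompleteSpace H]
    [NormedAddCommGroup G] [InnerProductSpace ℝ G] [CompleteSpace G]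
    (V V' : H →L[ℝ] H) (W W' : G →L[ℝ] G) (D : H →L[ℝ] G)
    (hV_sa : ∀ x y : H, ⟪V x, y⟫ = ⟪x, V y⟫)
    (hW_sa : ∀ x y : G, ⟪W x, y⟫ = ⟪x, W y⟫)
    (hV_pos : ∃ ρ > (0:ℝ), ∀ x : H, ρ * ‖x‖ ^ 2 ≤ ⟪V x, x⟫)
    (hW_pos : ∃ ρ > (0:ℝ), ∀ x : G, ρ * ‖x‖ ^ 2 ≤ ⟪W x, x⟫)
    (hV' : (∀ x : H, V (V' x) = x) ∧ (∀ x : H, V' (V x) = x))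
    (hW' : (∀ x : G, W (W' x) = x) ∧ (∀ x : G, W' (W x) = x))
    (κ : ℝ) (hκ0 : 0 ≤ κ) (hκ1 : κ < 1)
    (hbound : ∀ v : G,
      ⟪V ((ContinuousLinearMap.adjoint D) v), (ContinuousLinearMap.adjoint D) v⟫ ≤
        κ ^ 2 * ⟪W' v, v⟫) :
    -- self-adjoint:
    (∀ v v' : G,
      ⟪W' v - D (V ((ContinuousLinearMap.adjoint D) v)), v'⟫ =
      ⟪v, W' v' - D (V ((ContinuousLinearMap.adjoint D) v'))⟫) ∧
    -- strongly positive, with the stated quantitative bounds: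
    (∀ v : G,
      (1 - κ ^ 2) * ⟪W' v, v⟫ ≤ ⟪W' v - D (V ((ContinuousLinearMap.adjoint D) v)), v⟫ ∧
      ((1 - κ ^ 2) / ‖W‖) * ‖v‖ ^ 2 ≤ (1 - κ ^ 2) * ⟪W' v, v⟫) := by
  obtain ⟨ρ, hρ, hWρ⟩ := hW_pos
  have hW_nonneg : ∀ x : G, 0 ≤ ⟪W x, x⟫ := fun x => le_trans (by positivity) (hWρ x)
  have hW'_sa : ∀ x y : G, ⟪W' x, y⟫ = ⟪x, W' y⟫ := fun x y => by
    simpa only [hW'.1] using (hW_sa (W' x) (W' y)).symm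
  have hW'_nonneg : ∀ v : G, 0 ≤ ⟪W' v, v⟫ := fun v => by
    simpa only [hW'.1, real_inner_comm] using hW_nonneg (W' v)
  have hnorm : ∀ v : G, ‖v‖ ^ 2 ≤ ‖W‖ * ⟪W' v, v⟫ := fun v => by
    simpa only [hW'.1, real_inner_comm] using
      norm_sq_apply_le_opNorm_mul_inner W hW_sa hW_nonneg (W' v)
  refine ⟨fun v v' => ?_, fun v => ⟨?_, ?_⟩⟩
  · rw [inner_sub_left, inner_sub_right, hW'_sa, ← ContinuousLinearMap.adjoint_inner_right D,
      ← ContinuousLinearMap.adjoint_inner_left D, hV_sa]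
  · rw [inner_sub_left, ← ContinuousLinearMap.adjoint_inner_right D]
    linarith [hbound v]
  · have hκ : 0 ≤ 1 - κ ^ 2 := by nlinarith
    rw [div_mul_eq_mul_div, mul_div_assoc]
    refine mul_le_mul_of_nonneg_left ?_ hκ
    exact div_le_of_le_mul₀ (norm_nonneg _) (hW'_nonneg v) (by linarith [hnorm v])
end

section
/- Let K be a real Hilbert space, let β > 0, let B : K → K be β-cocoercive, and let U : K → K be a bounded self-adjoint strongly positive linear operator. Then the operator U∘B is β‖U‖^{−1}-cocoercive with respect to the inner product ⟨x, y⟩_{U^{−1}} = ⟨U^{−1} x, y⟩; equivalently, for all x, y ∈ K, ⟨B x − B y, x − y⟩ ≥ (β/‖U‖) ⟨U(B x − B y), B x − B y⟩. -/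
open RealInnerProductSpace

/-- if `B` is `β`-cocoercive and `U` is a bounded self-adjoint strongly
positive operator, then `U ∘ B` is `β‖U‖⁻¹`-cocoercive with respect to the inner product
`⟪x, y⟫_{U⁻¹} = ⟪U⁻¹ x, y⟫`; equivalently the inequality stated below holds. -/
theorem cocoercive_precond
    {K : Type*} [NormedAddCommGroup K] [InnerProductSpace ℝ K] [CompleteSpace K]
    (β : ℝ) (hβ : 0 < β) (B : K → K)
    (hB : ∀ z₁ z₂ : K, β * ‖B z₁ - B z₂‖ ^ 2 ≤ ⟪z₁ - z₂, B z₁ - B z₂⟫)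
    (U : K →L[ℝ] K)
    (hU_sa : ∀ x y : K, ⟪U x, y⟫ = ⟪x, U y⟫)
    (ρ : ℝ) (hρ : 0 < ρ) (hU_pos : ∀ x : K, ρ * ‖x‖ ^ 2 ≤ ⟪U x, x⟫) :
    ∀ x y : K, (β / ‖U‖) * ⟪U (B x - B y), B x - B y⟫ ≤ ⟪B x - B y, x - y⟫ := by
  intro x y
  set w := B x - B y
  have hUw : ⟪U w, w⟫ ≤ ‖U‖ * ‖w‖ ^ 2 := by
    calc ⟪U w, w⟫ ≤ ‖U w‖ * ‖w‖ := real_inner_le_norm _ _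
      _ ≤ ‖U‖ * ‖w‖ * ‖w‖ := by gcongr; exact U.le_opNorm w
      _ = ‖U‖ * ‖w‖ ^ 2 := by ring
  calc β / ‖U‖ * ⟪U w, w⟫ ≤ β / ‖U‖ * (‖U‖ * ‖w‖ ^ 2) := by gcongr
    _ = ‖U‖ / ‖U‖ * (β * ‖w‖ ^ 2) := by ring
    _ ≤ β * ‖w‖ ^ 2 := mul_le_of_le_one_left (by positivity) (div_self_le_one _)
    _ ≤ ⟪x - y, w⟫ := hB x y
    _ = ⟪w, x - y⟫ := real_inner_comm _ _
end
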